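/- arXiv:1501.01696 — 2 statements merged into one kernel-verified Lean document; each statement's English description precedes it below -/
import Mathlib

section
/- Let m ≥ 2, w ≥ 3, and let f be a symmetric nonnegative function on pairs of distinct elements of {1, …, m}. Let S = {1, …, m} × {1, …, w−1} (record s_i^j has set ID i and internal ID j), let L = Σ_{1 ≤ u < v ≤ m} f(u, v), and define the symmetric function f′ on pairs of distinct elements of S by: f′(s_i^c, s_i^d) = L for c ≠ d; f′(s_i^c, s_j^c) = f(i, j) for i ≠ j; and f′ = 0 on all other pairs. Then for every permutation σ of {1, …, m}, the stacked aligned ordering s_{σ(1)}^1, …, s_{σ(1)}^{w−1}, s_{σ(2)}^1, …, s_{σ(2)}^{w−1}, …, s_{σ(m)}^1, …, s_{σ(m)}^{w−1} of S has w-score equal to m·((w−1)(w−2)/2)·L + (w − 1)·Σ_{i=1}^{m−1} f(σ(i), σ(i+1)). -/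
/-- The w-score of a list `l` under scoring function `f` with window size `w`:
`Σ_{i < j, j − i ≤ w − 1} f(l_i, l_j)`. -/
noncomputable def wScore {α : Type*} (f : α → α → ℝ) (w : ℕ) (l : List α) : ℝ :=
  ∑ i : Fin l.length, ∑ j : Fin l.length,
    if (i : ℕ) < (j : ℕ) ∧ (j : ℕ) - (i : ℕ) ≤ w - 1 then f (l.get i) (l.get j) else 0

/-- The 2-score of a list: the sum of `f` over consecutive pairs of the list. -/
def chainSum {α β : Type*} [AddCommMonoid β] (f : α → α → β) (l : List α) : β :=
  (List.zipWith f l l.tail).sum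

theorem wScore_ofFn {α : Type*} (f : α → α → ℝ) (w n : ℕ) (g : Fin n → α) :
    wScore f w (List.ofFn g) = ∑ i : Fin n, ∑ j : Fin n,
      if (i : ℕ) < (j : ℕ) ∧ (j : ℕ) - (i : ℕ) ≤ w - 1 then f (g i) (g j) else 0 := by
  unfold wScore
  refine Fintype.sum_equiv (finCongr List.length_ofFn) _ _ fun i => ?_
  refine Fintype.sum_equiv (finCongr List.length_ofFn) _ _ fun j => ?_
  simp
  rfl

theorem flatten_ofFn_ofFn {α : Type*} {m k : ℕ} (g : Fin m × Fin k → α) :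
    (List.ofFn fun i => List.ofFn fun c => g (i, c)).flatten =
      List.ofFn (g ∘ finProdFinEquiv.symm) := by
  rw [List.ofFn_mul]
  congr 2
  funext i
  congr 1
  funext c
  refine congrArg g ((Equiv.eq_symm_apply _).2 (Fin.ext ?_))
  simp [add_comm, mul_comm]

theorem chainSum_ofFn_succ {α β : Type*} [AddCommMonoid β] (f : α → α → β) {n : ℕ}
    (g : Fin (n + 1) → α) :
    chainSum f (List.ofFn g) = ∑ i : Fin n, f (g i.castSucc) (g i.succ) := by
  have h : List.zipWith f (List.ofFn g) (List.ofFn g).tail =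
      List.ofFn fun i : Fin n => f (g i.castSucc) (g i.succ) := by
    apply List.ext_getElem
    · simp
    · intro i _ _
      simp only [List.getElem_zipWith, List.getElem_tail, List.getElem_ofFn]
      rfl
  rw [chainSum, h, List.sum_ofFn]

theorem chainSum_ofFn {α β : Type*} [AddCommMonoid β] (f : α → α → β) {n : ℕ}
    (g : Fin n → α) :
    chainSum f (List.ofFn g) =
      ∑ i : Fin n, ∑ j : Fin n, if (i : ℕ) + 1 = j then f (g i) (g j) else 0 := by
  cases n with
  | zero => simp [chainSum]
  | succ n =>
    rw [chainSum_ofFn_succ]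
    refine .trans ?_ (Fin.sum_univ_castSucc _).symm
    have hlast : ∀ j : Fin (n + 1), n + 1 ≠ (j : ℕ) := fun j => j.isLt.ne'
    simp only [Fin.val_last, hlast, if_false, Finset.sum_const_zero, add_zero]
    refine Finset.sum_congr rfl fun i _ => ?_
    have h : ∀ j : Fin (n + 1), (i.castSucc : ℕ) + 1 = j ↔ i.succ = j := fun j => by
      simp [Fin.ext_iff]
    simp only [h, Finset.sum_ite_eq, Finset.mem_univ, if_true]

theorem sum_sum_ite_lt (k : ℕ) (L : ℝ) :
    (∑ c : Fin k, ∑ d : Fin k, if c < d then L else 0) = (k : ℝ) * ((k : ℝ) - 1) / 2 * L := by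
  induction k with
  | zero => simp
  | succ k ih =>
    simp only [Fin.sum_univ_succ, Fin.succ_lt_succ_iff, Fin.succ_pos, Fin.not_lt_zero,
      Finset.sum_add_distrib, ih]
    simp
    ring

/-- In a stack of blocks of size `k`, offset `d` of block `b` follows offset `c` of block `a` at
distance at most `k` iff it comes later in the same block, or sits in the next block at an offset
of at most `c`. -/
theorem stacked_window_iff {k a b c d : ℕ} (hc : c < k) (hd : d < k) :
    (c + k * a < d + k * b ∧ d + k * b - (c + k * a) ≤ k) ↔
      (a = b ∧ c < d) ∨ (a + 1 = b ∧ d ≤ c) := by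
  rcases lt_trichotomy a b with h | rfl | h
  · obtain ⟨e, rfl⟩ := Nat.exists_eq_add_of_lt h
    rcases e with _ | e
    · rw [add_zero, mul_add, mul_one]
      omega
    · have : k * (a + (e + 1) + 1) = k * a + k * e + k + k := by ring
      have := Nat.zero_le (k * e)
      omega
  · omega
  · have : k * (b + 1) ≤ k * a := Nat.mul_le_mul_left k h
    rw [mul_add, mul_one] at this
    omega

/-- In the scaled instance `S = {1,…,m} × {1,…,w−1}` with scoring function
`f′` (equal to `L = Σ_{u<v} f(u,v)` within an internal set, `f(i,j)` between records of equal
internal ID, and `0` otherwise), every stacked aligned ordering determined by a permutation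
`σ` of `{1,…,m}` has w-score `m·((w−1)(w−2)/2)·L + (w−1)·Σ_{i=1}^{m−1} f(σ(i),σ(i+1))`. -/
theorem wScore_stacked_aligned (m w : ℕ) (hm : 2 ≤ m) (hw : 3 ≤ w)
    (f : Fin m → Fin m → ℝ)
    (hsymm : ∀ u v, f u v = f v u) (hnonneg : ∀ u v, 0 ≤ f u v)
    (L : ℝ)
    (hL : L = ∑ p ∈ Finset.univ.filter (fun p : Fin m × Fin m => p.1 < p.2), f p.1 p.2)
    (f' : Fin m × Fin (w - 1) → Fin m × Fin (w - 1) → ℝ)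
    (hsymm' : ∀ x y, f' x y = f' y x)
    (h1 : ∀ (i : Fin m) (c d : Fin (w - 1)), c ≠ d → f' (i, c) (i, d) = L)
    (h2 : ∀ (i j : Fin m) (c : Fin (w - 1)), i ≠ j → f' (i, c) (j, c) = f i j)
    (h3 : ∀ (i j : Fin m) (c d : Fin (w - 1)), i ≠ j → c ≠ d → f' (i, c) (j, d) = 0)
    (σ : Equiv.Perm (Fin m)) :
    wScore f' w
        (List.ofFn (fun i : Fin m =>
          List.ofFn (fun c : Fin (w - 1) => (σ i, c)))).flatten
      = (m : ℝ) * (((w : ℝ) - 1) * ((w : ℝ) - 2) / 2) * L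
        + ((w : ℝ) - 1) * chainSum f (List.ofFn ⇑σ) := by
  obtain ⟨k, rfl⟩ : ∃ k, w = k + 1 := ⟨w - 1, by omega⟩
  change Fin m × Fin k → Fin m × Fin k → ℝ at f'
  change ∀ (i : Fin m) (c d : Fin k), c ≠ d → f' (i, c) (i, d) = L at h1
  change ∀ (i j : Fin m) (c : Fin k), i ≠ j → f' (i, c) (j, c) = f i j at h2
  change ∀ (i j : Fin m) (c d : Fin k), i ≠ j → c ≠ d → f' (i, c) (j, d) = 0 at h3
  change wScore f' (k + 1)
    (List.ofFn fun i : Fin m => List.ofFn fun c : Fin k => (σ i, c)).flatten = _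
  have hpair : ∀ (a b : Fin m) (c d : Fin k),
      (if (c : ℕ) + k * a < d + k * b ∧ (d : ℕ) + k * b - (c + k * a) ≤ k
        then f' (σ a, c) (σ b, d) else 0) =
      (if a = b then if c < d then L else 0 else 0) +
        (if (a : ℕ) + 1 = b then if c = d then f (σ a) (σ b) else 0 else 0) := by
    intro a b c d
    simp only [stacked_window_iff c.isLt d.isLt]
    by_cases hab : a = b
    · subst hab
      by_cases hcd : c < d
      · simp [hcd, h1 _ _ _ hcd.ne]
      · simp [hcd]
    · have hσ : σ a ≠ σ b := σ.injective.ne hab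
      have hv : (a : ℕ) ≠ b := Fin.val_ne_of_ne hab
      by_cases hcd : c = d
      · subst hcd
        simp [hab, hv, h2 _ _ _ hσ]
      · simp [hab, hcd, h3 _ _ _ _ hσ hcd]
  have hscore : wScore f' (k + 1)
      (List.ofFn fun i : Fin m => List.ofFn fun c : Fin k => (σ i, c)).flatten =
      ∑ a : Fin m, ∑ b : Fin m, ∑ c : Fin k, ∑ d : Fin k,
        if (c : ℕ) + k * a < d + k * b ∧ (d : ℕ) + k * b - (c + k * a) ≤ k
          then f' (σ a, c) (σ b, d) else 0 := by
    rw [flatten_ofFn_ofFn fun p : Fin m × Fin k => (σ p.1, p.2), wScore_ofFn]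
    simp only [← finProdFinEquiv.sum_comp, Fintype.sum_prod_type, Function.comp_apply,
      Equiv.symm_apply_apply, finProdFinEquiv_apply_val, Nat.add_sub_cancel]
    exact Finset.sum_congr rfl fun a _ => Finset.sum_comm
  have hsame : ∀ a b : Fin m,
      (∑ c : Fin k, ∑ d : Fin k, if a = b then if c < d then L else 0 else 0) =
        if a = b then (k : ℝ) * ((k : ℝ) - 1) / 2 * L else 0 := by
    intro a b
    split_ifs
    · exact sum_sum_ite_lt k L
    · simp
  have hnext : ∀ a b : Fin m,
      (∑ c : Fin k, ∑ d : Fin k,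
        if (a : ℕ) + 1 = b then if c = d then f (σ a) (σ b) else 0 else 0) =
        (k : ℝ) * if (a : ℕ) + 1 = b then f (σ a) (σ b) else 0 := by
    intro a b
    split_ifs <;> simp
  rw [hscore, chainSum_ofFn]
  simp only [hpair, Finset.sum_add_distrib, hsame, hnext, ← Finset.mul_sum]
  simp
  ring
end

section
/- Let m ≥ 2, w ≥ 3, S = {1, …, m} × {1, …, w−1}, and let f′ be the scaled scoring function built from a symmetric nonnegative f on {1, …, m} (f′(s_i^c, s_i^d) = L for c ≠ d where L = Σ_{1 ≤ u < v ≤ m} f(u, v); f′(s_i^c, s_j^c) = f(i, j) for i ≠ j; f′ = 0 otherwise). Consider a stacked ordering of S determined by a permutation σ of {1, …, m} (the order of the internal sets) and permutations π_1, …, π_m of {1, …, w−1} (the order of internal IDs within each sub-list). Then for every pivot p ∈ {1, …, m}, the w-score of this stacked ordering is at most the w-score of its alignment with pivot p, namely the stacked ordering with the same block order σ in which every sub-list is ordered by π_p. -/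
/-- The w-score of a concatenation of `m` blocks of length `k`, as a sum over pairs of blocks. -/
theorem wScore_flatten_ofFn {α : Type*} (f : α → α → ℝ) (w m k : ℕ) (g : Fin m → Fin k → α) :
    wScore f w (List.ofFn fun i => List.ofFn fun c => g i c).flatten =
      ∑ i : Fin m, ∑ j : Fin m, ∑ c : Fin k, ∑ d : Fin k,
        if (c + k * i : ℕ) < d + k * j ∧ (d + k * j : ℕ) - (c + k * i) ≤ w - 1
          then f (g i c) (g j d) else 0 := by
  have h : (List.ofFn fun i => List.ofFn fun c => g i c).flatten =
      List.ofFn fun x : Fin (m * k) =>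
        g (finProdFinEquiv.symm x).1 (finProdFinEquiv.symm x).2 := by
    rw [List.ofFn_mul]
    congr! 5 with i c
    generalize_proofs hlt
    have hx : (⟨i * k + c, hlt⟩ : Fin (m * k)) = finProdFinEquiv (i, c) :=
      Fin.ext (by rw [finProdFinEquiv_apply_val]; ring)
    rw [hx, Equiv.symm_apply_apply]
  rw [h, wScore_ofFn, ← finProdFinEquiv.sum_comp, Fintype.sum_prod_type]
  refine Finset.sum_congr rfl fun i _ => ?_
  rw [Finset.sum_comm (s := (Finset.univ : Finset (Fin m)))]
  refine Finset.sum_congr rfl fun c _ => ?_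
  rw [← finProdFinEquiv.sum_comp, Fintype.sum_prod_type]
  simp only [Equiv.symm_apply_apply, finProdFinEquiv_apply_val]

/-- Two positions of distinct blocks of length `k` can only be within distance `k` of each other
if the later block immediately follows the earlier one. -/
theorem block_eq_succ_of_window {k i j c d : ℕ} (hc : c < k) (hd : d < k) (hij : i ≠ j)
    (hlt : c + k * i < d + k * j) (hle : d + k * j - (c + k * i) ≤ k) : j = i + 1 := by
  obtain h | h : j < i ∨ i + 2 ≤ j ∨ j = i + 1 := by omega
  · have := Nat.mul_le_mul_left k (Nat.succ_le_of_lt h)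
    rw [Nat.mul_succ] at this
    omega
  · refine h.resolve_left fun h => ?_
    have := Nat.mul_le_mul_left k h
    rw [Nat.mul_add] at this
    omega

/-- In the scaled instance `S = {1,…,m} × {1,…,w−1}` with scoring function
`f′`, consider the stacked ordering determined by a permutation `σ` of the set IDs and
permutations `π_1,…,π_m` of the internal IDs within each sub-list. For every pivot `p`,
its w-score is at most the w-score of its alignment with pivot `p` (the stacked ordering
with the same block order `σ` in which every sub-list is ordered by `π_p`). -/
theorem wScore_stacked_le_aligned (m w : ℕ) (hm : 2 ≤ m) (hw : 3 ≤ w)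
    (f : Fin m → Fin m → ℝ)
    (hsymm : ∀ u v, f u v = f v u) (hnonneg : ∀ u v, 0 ≤ f u v)
    (L : ℝ)
    (hL : L = ∑ p ∈ Finset.univ.filter (fun p : Fin m × Fin m => p.1 < p.2), f p.1 p.2)
    (f' : Fin m × Fin (w - 1) → Fin m × Fin (w - 1) → ℝ)
    (hsymm' : ∀ x y, f' x y = f' y x)
    (h1 : ∀ (i : Fin m) (c d : Fin (w - 1)), c ≠ d → f' (i, c) (i, d) = L)
    (h2 : ∀ (i j : Fin m) (c : Fin (w - 1)), i ≠ j → f' (i, c) (j, c) = f i j)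
    (h3 : ∀ (i j : Fin m) (c d : Fin (w - 1)), i ≠ j → c ≠ d → f' (i, c) (j, d) = 0)
    (σ : Equiv.Perm (Fin m)) (π : Fin m → Equiv.Perm (Fin (w - 1))) (p : Fin m) :
    wScore f' w
        (List.ofFn (fun i : Fin m =>
          List.ofFn (fun c : Fin (w - 1) => (σ i, π i c)))).flatten
      ≤ wScore f' w
        (List.ofFn (fun i : Fin m =>
          List.ofFn (fun c : Fin (w - 1) => (σ i, π p c)))).flatten := by
  rw [wScore_flatten_ofFn, wScore_flatten_ofFn]
  refine Finset.sum_le_sum fun i _ => Finset.sum_le_sum fun j _ =>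
    Finset.sum_le_sum fun c _ => ?_
  by_cases hij : i = j
  · subst hij
    refine Finset.sum_le_sum fun d _ => ?_
    split_ifs with hcd
    · have hne : c ≠ d := by
        rintro rfl
        exact lt_irrefl _ hcd.1
      rw [h1 _ _ _ ((π i).injective.ne hne), h1 _ _ _ ((π p).injective.ne hne)]
    · exact le_rfl
  · have hσ : σ i ≠ σ j := σ.injective.ne hij
    have hij' : (i : ℕ) ≠ j := fun h => hij (Fin.ext h)
    have hf' : ∀ a b : Fin (w - 1), 0 ≤ f' (σ i, a) (σ j, b) := by
      intro a b
      by_cases hab : a = b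
      · rw [hab, h2 _ _ _ hσ]
        exact hnonneg _ _
      · rw [h3 _ _ _ _ hσ hab]
    rw [Finset.sum_eq_single ((π j).symm (π i c))]
    · refine le_trans ?_ (Finset.single_le_sum (f := fun d : Fin (w - 1) => ite _ _ _)
        (fun d _ => ?_) (Finset.mem_univ c))
      · simp only [Equiv.apply_symm_apply, h2 _ _ _ hσ]
        split_ifs with hw₁ hw₂ hw₂
        · exact le_rfl
        · have hj := block_eq_succ_of_window c.2 (Fin.is_lt _) hij' hw₁.1 hw₁.2
          rw [hj, Nat.mul_succ] at hw₂
          omega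
        · exact hnonneg _ _
        · exact le_rfl
      · split_ifs
        · exact hf' _ _
        · exact le_rfl
    · intro d _ hd
      rw [h3 _ _ _ _ hσ fun h => hd (by rw [h, Equiv.symm_apply_apply]), ite_self]
    · simp
end
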